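/- Let w be a permutation of {1,…,n} and let i be an index with |w(i) − i| = 1. Then td(w) − td(fl_i(w)) = ℓ(w) − ℓ(fl_i(w)) + 1. -/

import Mathlib

/-- The (Coxeter) length of a permutation: its number of inversions,
i.e. pairs `(a,b)` with `a < b` and `w a > w b`. -/
def invLen {n : ℕ} (w : Equiv.Perm (Fin n)) : ℕ :=
  (Finset.univ.filter (fun p : Fin n × Fin n => p.1 < p.2 ∧ w p.2 < w p.1)).card

/-- The number of cycles in the cycle decomposition of `w`,
where fixed points count as cycles. -/
def numCycles {n : ℕ} (w : Equiv.Perm (Fin n)) : ℕ :=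
  w.cycleType.card + (Finset.univ.filter (fun i : Fin n => w i = i)).card

/-- The reflection length of a permutation of `{1,…,n}`: `n` minus the number of
cycles in its cycle decomposition (fixed points counting as cycles). -/
def reflLen {n : ℕ} (w : Equiv.Perm (Fin n)) : ℕ :=
  n - numCycles w

/-- The total displacement `td(w) = Σ_i |w(i) - i|`. -/
def totalDisp {n : ℕ} (w : Equiv.Perm (Fin n)) : ℕ :=
  ∑ i : Fin n, ((w i : ℤ) - (i : ℤ)).natAbs

/-- A permutation is shallow if `ℓ(w) + ℓ_T(w) = td(w)`. -/
def IsShallow {n : ℕ} (w : Equiv.Perm (Fin n)) : Prop :=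
  invLen w + reflLen w = totalDisp w

/-- The `i`-th flattening of `w`: remove the `i`-th entry of the one-line notation
and renumber down by one every entry greater than `w i`.  Position `k` of `Fin n`
corresponds to position `i.succAbove k` of `Fin (n+1)`, and value `m` corresponds
to value `(w i).succAbove m`; this is implemented by deleting the point `i` from the
source and `w i` from the target via `finSuccEquiv'`. -/
def flatten {n : ℕ} (w : Equiv.Perm (Fin (n + 1))) (i : Fin (n + 1)) : Equiv.Perm (Fin n) :=
  Equiv.removeNone ((finSuccEquiv' i).symm.trans (w.trans (finSuccEquiv' (w i))))

/-- `v` has a left-to-right maximum at position `j` if `v j > v i` for all `i < j`. -/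
def LeftToRightMaxAt {m : ℕ} (v : Equiv.Perm (Fin m)) (j : Fin m) : Prop :=
  ∀ i : Fin m, i < j → v i < v j

/-- `v` has a right-to-left minimum at position `j` if `v j < v i` for all `i > j`. -/
def RightToLeftMinAt {m : ℕ} (v : Equiv.Perm (Fin m)) (j : Fin m) : Prop :=
  ∀ i : Fin m, j < i → v j < v i

theorem succAbove_flatten {n : ℕ} (w : Equiv.Perm (Fin (n + 1))) (i : Fin (n + 1))
    (k : Fin n) : (w i).succAbove (flatten w i k) = w (i.succAbove k) := by
  have hne : w (i.succAbove k) ≠ w i := fun h => Fin.succAbove_ne i k (w.injective h)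
  obtain ⟨m, hm⟩ := Fin.exists_succAbove_eq hne
  have h : some (flatten w i k) = some m := by
    unfold flatten
    rw [Equiv.removeNone_some]
    · simp [← hm]
    · exact ⟨m, by simp [← hm]⟩
  rw [Option.some.inj h, hm]

theorem invLen_eq_sum {n : ℕ} (w : Equiv.Perm (Fin n)) :
    invLen w = ∑ a : Fin n, ∑ b : Fin n, if a < b ∧ w b < w a then 1 else 0 := by
  rw [invLen, Finset.card_filter, Fintype.sum_prod_type]

/-- Flattening at `i` removes exactly the inversions that involve the position `i`. -/
theorem invLen_eq_flatten_add {n : ℕ} (w : Equiv.Perm (Fin (n + 1))) (i : Fin (n + 1)) :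
    invLen w = invLen (flatten w i) + ∑ k : Fin n,
      ((if i < i.succAbove k ∧ w (i.succAbove k) < w i then 1 else 0) +
        if i.succAbove k < i ∧ w i < w (i.succAbove k) then 1 else 0) := by
  rw [invLen_eq_sum w, invLen_eq_sum (flatten w i), Fin.sum_univ_succAbove _ i]
  simp only [Fin.sum_univ_succAbove _ i, ← succAbove_flatten, Fin.succAbove_lt_succAbove_iff,
    Finset.sum_add_distrib, lt_irrefl, false_and, if_false]
  ring

/-- If `|w i - i| ≤ 1`, then for every other position the displacement decreases on
flattening by one if that position forms an inversion with `i`, and is unchanged otherwise. -/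
theorem displacement_succAbove {n : ℕ} (w : Equiv.Perm (Fin (n + 1))) (i : Fin (n + 1))
    (hi : ((w i : ℤ) - (i : ℤ)).natAbs ≤ 1) (k : Fin n) :
    ((w (i.succAbove k) : ℤ) - (i.succAbove k : ℤ)).natAbs =
      ((flatten w i k : ℤ) - (k : ℤ)).natAbs +
      ((if i < i.succAbove k ∧ w (i.succAbove k) < w i then 1 else 0) +
        if i.succAbove k < i ∧ w i < w (i.succAbove k) then 1 else 0) := by
  rw [← succAbove_flatten]
  generalize w i = j at *
  generalize flatten w i k = m
  simp only [Fin.succAbove, Fin.lt_def, Fin.val_castSucc]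
  split_ifs <;> simp only [Fin.val_castSucc, Fin.val_succ] at * <;> omega

/-- If `|w i - i| = 1`, then `td(w) - td(fl_i(w)) = ℓ(w) - ℓ(fl_i(w)) + 1`. -/
theorem totalDisp_sub_flatten_of_near {n : ℕ} (w : Equiv.Perm (Fin (n + 1)))
    (i : Fin (n + 1)) (hi : ((w i : ℤ) - (i : ℤ)).natAbs = 1) :
    (totalDisp w : ℤ) - (totalDisp (flatten w i) : ℤ)
      = (invLen w : ℤ) - (invLen (flatten w i) : ℤ) + 1 := by
  have htd : totalDisp w = 1 + ∑ k : Fin n,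
      ((w (i.succAbove k) : ℤ) - (i.succAbove k : ℤ)).natAbs := by
    rw [totalDisp, Fin.sum_univ_succAbove _ i, hi]
  simp only [displacement_succAbove w i hi.le, Finset.sum_add_distrib (M := ℕ)] at htd
  have hfl : totalDisp (flatten w i) =
    ∑ k : Fin n, ((flatten w i k : ℤ) - (k : ℤ)).natAbs := rfl
  have hinv := invLen_eq_flatten_add w i
  rw [Finset.sum_add_distrib] at hinv
  omega
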